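/- Let u : ℝ × ℝ → ℝ, (q,t) ↦ u(q,t), be a C² function with u(q+1, t) = u(q, t) for all (q,t), and suppose there is a constant K > 0 such that ∫₀¹ u_q(q,t)² dq < K for all t. Suppose f : ℝ × ℝ × ℝ → ℝ, (α, q, t) ↦ f(α, q, t), is a C² function such that: (i) f(α, q+1, t) = f(α, q, t) for all (α,q,t); (ii) for each fixed α, the function (q,t) ↦ f(α,q,t) is a global classical solution of the forced Burgers equation f_t + f·f_q + u_q = 0 on ℝ²; (iii) for each fixed (q,t), the map α ↦ f(α, q, t) is a C² diffeomorphism of ℝ (in particular a strictly monotone bijection of ℝ). Then u_q ≡ 0 and, for each fixed (q,t), f(α,q,t) is independent of (q,t) (the foliation consists of horizontal lines). -/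

import Mathlib

open MeasureTheory Set

/-- Cauchy–Schwarz inequality for interval integrals of continuous functions. -/
theorem sq_intervalIntegral_mul_le {a b : ℝ} (hab : a ≤ b) {f g : ℝ → ℝ}
    (hf : Continuous f) (hg : Continuous g) :
    (∫ x in a..b, f x * g x) ^ 2 ≤ (∫ x in a..b, f x ^ 2) * ∫ x in a..b, g x ^ 2 := by
  have h : ∀ s : ℝ, 0 ≤ (∫ x in a..b, g x ^ 2) * (s * s) + (2 * ∫ x in a..b, f x * g x) * s
      + ∫ x in a..b, f x ^ 2 := by
    intro s
    have h1 : ∫ x in a..b, (f x + s * g x) ^ 2 = (∫ x in a..b, g x ^ 2) * (s * s)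
        + (2 * ∫ x in a..b, f x * g x) * s + ∫ x in a..b, f x ^ 2 := by
      have e : ∀ x, (f x + s * g x) ^ 2 = (s * s) * g x ^ 2 + (2 * s) * (f x * g x) + f x ^ 2 :=
        fun x => by ring
      simp_rw [e]
      rw [intervalIntegral.integral_add, intervalIntegral.integral_add,
        intervalIntegral.integral_const_mul, intervalIntegral.integral_const_mul]
      · ring
      all_goals exact Continuous.intervalIntegrable (by fun_prop) _ _
    rw [← h1]
    exact intervalIntegral.integral_nonneg hab fun x _ => sq_nonneg _
  have := discrim_le_zero h
  rw [discrim] at this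
  linarith

/-- Differentiation under an interval integral for jointly continuous data. -/
theorem hasDerivAt_intervalIntegral_of_continuous {a b : ℝ} {F F' : ℝ × ℝ → ℝ}
    (hF : Continuous F) (hF' : Continuous F')
    (h : ∀ s x, HasDerivAt (fun s => F (s, x)) (F' (s, x)) s) (s : ℝ) :
    HasDerivAt (fun s => ∫ x in a..b, F (s, x)) (∫ x in a..b, F' (s, x)) s := by
  obtain ⟨C, hC⟩ := ((isCompact_Icc (a := s - 1) (b := s + 1)).prod
    (isCompact_uIcc (a := a) (b := b))).exists_bound_of_continuousOn hF'.continuousOn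
  refine (intervalIntegral.hasDerivAt_integral_of_dominated_loc_of_deriv_le
    (F := fun s x => F (s, x)) (F' := fun s x => F' (s, x)) (bound := fun _ => C)
    (Icc_mem_nhds (a := s - 1) (b := s + 1) (by linarith) (by linarith)) ?_ ?_ ?_ ?_ ?_ ?_).2
  · exact Filter.Eventually.of_forall fun s =>
      Continuous.aestronglyMeasurable (by fun_prop)
  · exact Continuous.intervalIntegrable (by fun_prop) _ _
  · exact Continuous.aestronglyMeasurable (by fun_prop)
  · exact Filter.Eventually.of_forall fun x hx y hy =>
      hC (y, x) ⟨hy, uIoc_subset_uIcc hx⟩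
  · exact intervalIntegrable_const
  · exact Filter.Eventually.of_forall fun x _ y _ => h y x

/-- Lower bound for a global solution of a logistic differential inequality. -/
theorem neg_le_of_deriv_le_logistic {y y' : ℝ → ℝ} {a b : ℝ} (ha : 0 < a) (hb : 0 ≤ b)
    (hy : ∀ t, HasDerivAt y (y' t) t) (h : ∀ t, y' t ≤ a * (b ^ 2 - y t ^ 2)) (t₀ : ℝ) :
    -b ≤ y t₀ := by
  by_contra! hlt
  have hneg : ∀ t, y t ≤ y t₀ → b ^ 2 - y t ^ 2 ≤ b ^ 2 - y t₀ ^ 2 := fun t ht => by nlinarith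
  have h0 : b ^ 2 - y t₀ ^ 2 < 0 := by nlinarith
  have hcont : Continuous y := continuous_iff_continuousAt.2 fun t => (hy t).continuousAt
  have hle : ∀ t, t₀ ≤ t → y t ≤ y t₀ := by
    intro t ht
    refine image_le_of_deriv_right_lt_deriv_boundary' (a := t₀) (b := t) (f := y) (f' := y')
      (B := fun _ => y t₀) (B' := fun _ => 0) hcont.continuousOn
      (fun x _ => (hy x).hasDerivWithinAt) le_rfl continuousOn_const
      (fun x _ => hasDerivWithinAt_const _ _ _) ?_ (right_mem_Icc.2 ht)
    intro x _ hx
    have := h x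
    rw [hx] at this
    nlinarith
  set c := a * (1 - b ^ 2 / y t₀ ^ 2) with hc
  have hy0 : y t₀ < 0 := by linarith
  have hcpos : 0 < c := by
    refine mul_pos ha ?_
    rw [sub_pos, div_lt_one (by nlinarith)]
    linarith
  have hmono : ∀ t, t₀ ≤ t → c * (t - t₀) ≤ (y t)⁻¹ - (y t₀)⁻¹ := by
    intro t ht
    refine (convex_Icc t₀ t).mul_sub_le_image_sub_of_le_deriv (f := fun s => (y s)⁻¹) ?_ ?_ ?_
      t₀ (left_mem_Icc.2 ht) t (right_mem_Icc.2 ht) ht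
    · exact hcont.continuousOn.inv₀ fun x hx => by have := hle x hx.1; linarith
    · intro x hx
      rw [interior_Icc] at hx
      have := hle x hx.1.le
      exact ((hy x).inv (by linarith)).differentiableAt.differentiableWithinAt
    · intro x hx
      rw [interior_Icc] at hx
      have hx0 := hle x hx.1.le
      rw [((hy x).fun_inv (by linarith)).deriv]
      have h1 := h x
      have hpos : 0 < y x ^ 2 := by nlinarith
      have hpos0 : 0 < y t₀ ^ 2 := by nlinarith
      rw [le_div_iff₀ hpos]
      have h2 : b ^ 2 / y t₀ ^ 2 * y x ^ 2 ≥ b ^ 2 := by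
        rw [ge_iff_le, div_mul_eq_mul_div, le_div_iff₀ hpos0]
        exact mul_le_mul_of_nonneg_left (by nlinarith) (sq_nonneg b)
      rw [hc]
      nlinarith
  have h1 := hmono (t₀ + -(y t₀)⁻¹ / c) (by
    have : 0 < -(y t₀)⁻¹ / c := div_pos (by simpa using hy0) hcpos
    linarith)
  have h2 : (y (t₀ + -(y t₀)⁻¹ / c))⁻¹ < 0 := by
    rw [inv_lt_zero]
    have := hle (t₀ + -(y t₀)⁻¹ / c) (by
      have : 0 < -(y t₀)⁻¹ / c := div_pos (by simpa using hy0) hcpos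
      linarith)
    linarith
  rw [add_sub_cancel_left, mul_div_cancel₀ _ hcpos.ne'] at h1
  linarith

/-- A function on the whole line whose derivative is at most `a (b² - y²)` takes its
values in `[-b, b]`. -/
theorem abs_le_of_deriv_le_logistic {y y' : ℝ → ℝ} {a b : ℝ} (ha : 0 < a) (hb : 0 ≤ b)
    (hy : ∀ t, HasDerivAt y (y' t) t) (h : ∀ t, y' t ≤ a * (b ^ 2 - y t ^ 2)) (t₀ : ℝ) :
    |y t₀| ≤ b := by
  refine abs_le.2 ⟨neg_le_of_deriv_le_logistic ha hb hy h t₀, ?_⟩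
  have := neg_le_of_deriv_le_logistic (y := fun t => -y (-t)) (y' := fun t => y' (-t)) ha hb
    (fun t => by
      have := ((hy (-t)).comp t (hasDerivAt_neg t)).neg
      simpa [Function.comp_def] using! this) (fun t => by simpa using h (-t)) (-t₀)
  simp only [neg_neg] at this
  linarith

/-- Momentum cutoff vanishing to second order at `±N`. -/
noncomputable def cutoff (N p : ℝ) : ℝ := (1 - (p / N) ^ 2) ^ 2

theorem continuous_cutoff (N : ℝ) : Continuous (cutoff N) := by
  unfold cutoff; fun_prop

theorem cutoff_nonneg (N p : ℝ) : 0 ≤ cutoff N p := sq_nonneg _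

theorem div_sq_le_one {N p : ℝ} (hN : 0 < N) (hp : p ∈ Icc (-N) N) : (p / N) ^ 2 ≤ 1 := by
  rw [div_pow, div_le_one (by positivity)]
  nlinarith [hp.1, hp.2]

theorem cutoff_le_one {N p : ℝ} (hN : 0 < N) (hp : p ∈ Icc (-N) N) : cutoff N p ≤ 1 := by
  have := div_sq_le_one hN hp
  unfold cutoff
  nlinarith [sq_nonneg (p / N)]

/-- A symmetric integral of a nonnegative function grows with the interval. -/
theorem symm_integral_mono {h : ℝ → ℝ} (hc : Continuous h) (h0 : ∀ x, 0 ≤ h x) {M N : ℝ}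
    (hM : 0 ≤ M) (hMN : M ≤ N) : ∫ x in -M..M, h x ≤ ∫ x in -N..N, h x :=
  intervalIntegral.integral_mono_interval (by linarith) (by linarith) hMN
    (Filter.Eventually.of_forall h0) (hc.intervalIntegrable _ _)

section weights

variable {h : ℝ → ℝ} {M N : ℝ}

theorem integral_cutoff_mul_le (hc : Continuous h) (h0 : ∀ x, 0 ≤ h x) (hN : 0 < N) :
    ∫ p in -N..N, cutoff N p * h p ≤ ∫ p in -N..N, h p := by
  have := continuous_cutoff N
  refine intervalIntegral.integral_mono_on (by linarith)
    (Continuous.intervalIntegrable (by fun_prop) _ _) (hc.intervalIntegrable _ _) fun p hp => ?_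
  exact mul_le_of_le_one_left (h0 p) (cutoff_le_one hN hp)

theorem integral_le_integral_cutoff_mul (hc : Continuous h) (h0 : ∀ x, 0 ≤ h x) (hM : 0 ≤ M)
    (hN : 0 < N) (hMN : 2 * M ≤ N) :
    9 / 16 * ∫ p in -M..M, h p ≤ ∫ p in -N..N, cutoff N p * h p := by
  have := continuous_cutoff N
  refine le_trans ?_ (symm_integral_mono (M := M) (by fun_prop)
    (fun p => mul_nonneg (cutoff_nonneg N p) (h0 p)) hM (by linarith))
  rw [← intervalIntegral.integral_const_mul]
  refine intervalIntegral.integral_mono_on (by linarith)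
    (Continuous.intervalIntegrable (by fun_prop) _ _)
    (Continuous.intervalIntegrable (by fun_prop) _ _) fun p hp => ?_
  refine mul_le_mul_of_nonneg_right ?_ (h0 p)
  have h1 : (p / N) ^ 2 ≤ 1 / 4 := by
    rw [div_pow, div_le_iff₀ (by positivity)]
    nlinarith [hp.1, hp.2]
  unfold cutoff
  nlinarith

theorem integral_sq_mul_cutoff_mul_le_cutoff (hc : Continuous h) (h0 : ∀ x, 0 ≤ h x)
    (hN : 0 < N) :
    ∫ p in -N..N, (p / N) ^ 2 * (cutoff N p * h p) ≤ ∫ p in -N..N, cutoff N p * h p := by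
  have := continuous_cutoff N
  refine intervalIntegral.integral_mono_on (by linarith)
    (Continuous.intervalIntegrable (by fun_prop) _ _)
    (Continuous.intervalIntegrable (by fun_prop) _ _) fun p hp => ?_
  exact mul_le_of_le_one_left (mul_nonneg (cutoff_nonneg N p) (h0 p)) (div_sq_le_one hN hp)

theorem integral_sq_mul_cutoff_mul_le (hc : Continuous h) (h0 : ∀ x, 0 ≤ h x) (hM : 0 ≤ M)
    (hN : 0 < N) (hMN : M ≤ N) :
    ∫ p in -N..N, (p / N) ^ 2 * (cutoff N p * h p) ≤
      (M / N) ^ 2 * (∫ p in -M..M, h p) + ((∫ p in -N..N, h p) - ∫ p in -M..M, h p) := by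
  have := continuous_cutoff N
  have hi : ∀ a b, IntervalIntegrable h volume a b := fun a b => hc.intervalIntegrable a b
  have hi' : ∀ a b, IntervalIntegrable (fun p => (p / N) ^ 2 * (cutoff N p * h p)) volume a b :=
    fun a b => Continuous.intervalIntegrable (by fun_prop) _ _
  have outer : ∀ a b, a ≤ b → -N ≤ a → b ≤ N →
      ∫ p in a..b, (p / N) ^ 2 * (cutoff N p * h p) ≤ ∫ p in a..b, h p := by
    intro a b hab ha hb
    refine intervalIntegral.integral_mono_on hab (hi' _ _) (hi _ _) fun p hp => ?_
    have hp' : p ∈ Icc (-N) N := ⟨ha.trans hp.1, hp.2.trans hb⟩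
    exact (mul_le_of_le_one_left (mul_nonneg (cutoff_nonneg N p) (h0 p))
      (div_sq_le_one hN hp')).trans (mul_le_of_le_one_left (h0 p) (cutoff_le_one hN hp'))
  have inner : ∫ p in -M..M, (p / N) ^ 2 * (cutoff N p * h p) ≤
      (M / N) ^ 2 * ∫ p in -M..M, h p := by
    rw [← intervalIntegral.integral_const_mul]
    refine intervalIntegral.integral_mono_on (by linarith) (hi' _ _)
      ((hi _ _).const_mul _) fun p hp => ?_
    have hp' : p ∈ Icc (-N) N := ⟨by linarith [hp.1], by linarith [hp.2]⟩
    refine mul_le_mul ?_ (mul_le_of_le_one_left (h0 p) (cutoff_le_one hN hp'))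
      (mul_nonneg (cutoff_nonneg N p) (h0 p)) (sq_nonneg _)
    rw [div_pow, div_pow]
    exact div_le_div_of_nonneg_right (by nlinarith [hp.1, hp.2]) (by positivity)
  rw [← intervalIntegral.integral_add_adjacent_intervals (hi' (-N) (-M)) (hi' (-M) N),
    ← intervalIntegral.integral_add_adjacent_intervals (hi' (-M) M) (hi' M N),
    ← intervalIntegral.integral_add_adjacent_intervals (hi (-N) (-M)) (hi (-M) N),
    ← intervalIntegral.integral_add_adjacent_intervals (hi (-M) M) (hi M N)]
  have := outer (-N) (-M) (by linarith) le_rfl (by linarith)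
  have := outer M N hMN (by linarith) le_rfl
  linarith

end weights

set_option maxHeartbeats 1000000 in
/-- A priori bounds on quantities `V N` with derivative `-A - B`, where `A` is the integral of `m`
against the cutoff, force a nonnegative density `m` to vanish. -/
theorem density_eq_zero_of_dissipation {m : ℝ × ℝ → ℝ} (hm : Continuous m) (hm0 : ∀ x, 0 ≤ m x)
    {K : ℝ} (hK : 0 < K) {V B : ℝ → ℝ → ℝ}
    (hB : ∀ N, Continuous (B N))
    (hV : ∀ N, 0 < N → ∀ t,
      HasDerivAt (V N) (-(∫ p in -N..N, cutoff N p * m (t, p)) - B N t) t)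
    (hVA : ∀ N, 0 < N → ∀ t, V N t ^ 2 ≤ 2 * N * ∫ p in -N..N, cutoff N p * m (t, p))
    (hBD : ∀ N, 0 < N → ∀ t, B N t ^ 2 ≤
      32 * K / N * ∫ p in -N..N, (p / N) ^ 2 * (cutoff N p * m (t, p)))
    (x : ℝ × ℝ) : m x = 0 := by
  set X : ℝ → ℝ → ℝ := fun N t => ∫ p in -N..N, m (t, p) with hX
  set A : ℝ → ℝ → ℝ := fun N t => ∫ p in -N..N, cutoff N p * m (t, p) with hA
  set D : ℝ → ℝ → ℝ := fun N t => ∫ p in -N..N, (p / N) ^ 2 * (cutoff N p * m (t, p)) with hD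
  set E : ℝ → ℝ → ℝ := fun N T => ∫ t in -T..T, X N t with hE
  have hmt : ∀ t, Continuous fun p => m (t, p) := fun t => by fun_prop
  have hXc : ∀ N, Continuous (X N) := fun N =>
    intervalIntegral.continuous_parametric_intervalIntegral_of_continuous'
      (f := fun t p => m (t, p)) (by exact hm) _ _
  have hAc : ∀ N, Continuous (A N) := fun N => by
    have := continuous_cutoff N
    exact intervalIntegral.continuous_parametric_intervalIntegral_of_continuous'
      (f := fun t p => cutoff N p * m (t, p)) (by unfold Function.uncurry; fun_prop) _ _
  have hDc : ∀ N, Continuous (D N) := fun N => by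
    have := continuous_cutoff N
    exact intervalIntegral.continuous_parametric_intervalIntegral_of_continuous'
      (f := fun t p => (p / N) ^ 2 * (cutoff N p * m (t, p)))
      (by unfold Function.uncurry; fun_prop) _ _
  have hX0 : ∀ N, 0 ≤ N → ∀ t, 0 ≤ X N t := fun N hN t =>
    intervalIntegral.integral_nonneg (by linarith) fun p _ => hm0 _
  have hA0 : ∀ N, 0 < N → ∀ t, 0 ≤ A N t := fun N hN t =>
    intervalIntegral.integral_nonneg (by linarith) fun p _ =>
      mul_nonneg (cutoff_nonneg N p) (hm0 _)
  have hD0 : ∀ N, 0 < N → ∀ t, 0 ≤ D N t := fun N hN t =>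
    intervalIntegral.integral_nonneg (by linarith) fun p _ =>
      mul_nonneg (sq_nonneg _) (mul_nonneg (cutoff_nonneg N p) (hm0 _))
  have hXi : ∀ N a b, IntervalIntegrable (X N) volume a b :=
    fun N a b => (hXc N).intervalIntegrable a b
  have hAi : ∀ N a b, IntervalIntegrable (A N) volume a b :=
    fun N a b => (hAc N).intervalIntegrable a b
  have hBi : ∀ N a b, IntervalIntegrable (B N) volume a b :=
    fun N a b => (hB N).intervalIntegrable a b
  have hDi : ∀ N a b, IntervalIntegrable (D N) volume a b :=
    fun N a b => (hDc N).intervalIntegrable a b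
  have hDA : ∀ N, 0 < N → ∀ t, D N t ≤ A N t := fun N hN t =>
    integral_sq_mul_cutoff_mul_le_cutoff (hmt t) (fun p => hm0 _) hN
  have hAX : ∀ N, 0 < N → ∀ t, A N t ≤ X N t := fun N hN t =>
    integral_cutoff_mul_le (hmt t) (fun p => hm0 _) hN
  have hXA : ∀ M N, 0 ≤ M → 0 < N → 2 * M ≤ N → ∀ t, 9 / 16 * X M t ≤ A N t :=
    fun M N hM hN hMN t => integral_le_integral_cutoff_mul (hmt t) (fun p => hm0 _) hM hN hMN
  have hXmono : ∀ M N, 0 ≤ M → M ≤ N → ∀ t, X M t ≤ X N t := fun M N hM hMN t =>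
    symm_integral_mono (hmt t) (fun p => hm0 _) hM hMN
  have hEmono : ∀ M N T S, 0 ≤ M → M ≤ N → 0 ≤ T → T ≤ S → E M T ≤ E N S := by
    intro M N T S hM hMN hT hTS
    calc E M T ≤ E N T := intervalIntegral.integral_mono_on (by linarith) (hXi _ _ _)
          (hXi _ _ _) fun t _ => hXmono M N hM hMN t
      _ ≤ E N S := symm_integral_mono (hXc N) (hX0 N (hM.trans hMN)) hT hTS
  have hFTC : ∀ N, 0 < N → ∀ a b, ∫ t in a..b, A N t = V N a - V N b - ∫ t in a..b, B N t := by
    intro N hN a b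
    have h1 := intervalIntegral.integral_eq_sub_of_hasDerivAt (a := a) (b := b)
      (fun t _ => hV N hN t) ((hAi N a b).neg.sub (hBi N a b))
    have h2 : ∫ t in a..b, (-A N t - B N t) =
        -(∫ t in a..b, A N t) - ∫ t in a..b, B N t := by
      rw [← intervalIntegral.integral_neg]
      exact intervalIntegral.integral_sub (hAi N a b).neg (hBi N a b)
    have h3 := h2.symm.trans h1
    linarith
  have hBabs : ∀ N, 0 < N → ∀ l, 0 < l → ∀ t, |B N t| ≤ l / N + 8 * K / l * D N t := by
    intro N hN l hl t
    have h0 := hD0 N hN t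
    have hn : 0 ≤ l / N + 8 * K / l * D N t := by positivity
    refine abs_le_of_sq_le_sq ?_ hn
    refine (hBD N hN t).trans ?_
    have e : 32 * K / N * D N t = 4 * ((l / N) * (8 * K / l * D N t)) := by
      field_simp; ring
    change 32 * K / N * D N t ≤ _
    rw [e]
    nlinarith [sq_nonneg (l / N - 8 * K / l * D N t)]
  have hBA : ∀ N, 0 < N → ∀ t, |B N t| ≤ 16 * K / N + A N t / 2 := by
    intro N hN t
    have h1 := hBabs N hN (16 * K) (by positivity) t
    have e : 8 * K / (16 * K) = 1 / 2 := by field_simp; norm_num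
    rw [e] at h1
    linarith [hDA N hN t]
  have hVb : ∀ N, 0 < N → ∀ t, |V N t| ≤ 8 * √K := by
    intro N hN t
    refine abs_le_of_deriv_le_logistic (a := 1 / (4 * N)) (by positivity) (by positivity)
      (hV N hN) (fun t => ?_) t
    change -A N t - B N t ≤ _
    have h1 := (abs_le.1 (hBA N hN t)).1
    have h2 : V N t ^ 2 ≤ 2 * N * A N t := hVA N hN t
    have h3 : 1 / (4 * N) * V N t ^ 2 ≤ A N t / 2 := by
      rw [div_mul_eq_mul_div, div_le_iff₀ (by positivity)]
      linarith
    have h4 : 1 / (4 * N) * (8 * √K) ^ 2 = 16 * K / N := by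
      rw [mul_pow, Real.sq_sqrt hK.le]; field_simp; ring
    rw [mul_sub, h4]
    linarith
  set C : ℝ := 16 / 9 * (32 * √K + 64 * K) with hC
  have hEC : ∀ M T, 0 ≤ M → 0 ≤ T → E M T ≤ C := by
    intro M T hM hT
    set N := 1 + 2 * M + T with hN
    have hNpos : 0 < N := by positivity
    have h1 : 9 / 16 * E M T ≤ ∫ t in -T..T, A N t := by
      rw [hE, ← intervalIntegral.integral_const_mul]
      exact intervalIntegral.integral_mono_on (by linarith) ((hXi _ _ _).const_mul _)
        (hAi _ _ _) fun t _ => hXA M N hM hNpos (by linarith) t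
    have h2 : -(∫ t in -T..T, B N t) ≤ ∫ t in -T..T, (16 * K / N + A N t * (1 / 2)) := by
      rw [← intervalIntegral.integral_neg]
      refine intervalIntegral.integral_mono_on (by linarith) (hBi _ _ _).neg
        (intervalIntegrable_const.add ((hAi _ _ _).mul_const _)) fun t _ => ?_
      have := (abs_le.1 (hBA N hNpos t)).1
      linarith
    rw [intervalIntegral.integral_add intervalIntegrable_const ((hAi _ _ _).mul_const _),
      intervalIntegral.integral_const, intervalIntegral.integral_mul_const, smul_eq_mul] at h2
    have h3 := hFTC N hNpos (-T) T
    have h4 := (abs_le.1 (hVb N hNpos (-T))).2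
    have h5 := (abs_le.1 (hVb N hNpos T)).1
    have h6 : (T - -T) * (16 * K / N) ≤ 32 * K := by
      rw [mul_div_assoc', div_le_iff₀ hNpos]
      nlinarith
    rw [hC]
    linarith
  have hEsmall : ∀ M T, 0 ≤ M → 0 ≤ T → ∀ l, 0 < l → 9 / 16 * E M T ≤ (8 + 16 * K) * l := by
    intro M T hM hT l hl
    set d := l ^ 2 with hd
    have hdpos : 0 < d := by positivity
    set S : Set ℝ := {e | ∃ M T, 0 ≤ M ∧ 0 ≤ T ∧ e = E M T} with hS
    have hSne : S.Nonempty := ⟨_, 0, 0, le_rfl, le_rfl, rfl⟩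
    have hSbdd : BddAbove S := ⟨C, by rintro _ ⟨M, T, hM, hT, rfl⟩; exact hEC M T hM hT⟩
    obtain ⟨_, ⟨N₀, T₀, hN₀, hT₀, rfl⟩, hNT⟩ :=
      exists_lt_of_lt_csSup hSne (sub_lt_self (sSup S) hdpos)
    have hle : ∀ M T, 0 ≤ M → 0 ≤ T → E M T ≤ sSup S := fun M T hM hT =>
      le_csSup hSbdd ⟨M, T, hM, hT, rfl⟩
    have hCpos : 0 ≤ C := by positivity
    set N := 1 + N₀ + T₀ + 2 * M + T + N₀ ^ 2 * C / d with hN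
    have hq : 0 ≤ N₀ ^ 2 * C / d := by positivity
    have hN1 : 1 ≤ N := by linarith
    have hNpos : 0 < N := by linarith
    have htail : E N (2 * N) - E N N < d := by
      have := hle N (2 * N) (by linarith) (by linarith)
      have := hEmono N₀ N T₀ N hN₀ (by linarith) hT₀ (by linarith)
      linarith
    have hsplit : E N (2 * N) = (∫ t in (-(2 * N))..(-N), X N t) + E N N
        + ∫ t in N..(2 * N), X N t := by
      rw [hE]
      simp only
      rw [intervalIntegral.integral_add_adjacent_intervals (hXi _ _ _) (hXi _ _ _),
        intervalIntegral.integral_add_adjacent_intervals (hXi _ _ _) (hXi _ _ _)]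
    have hpos1 : 0 ≤ ∫ t in (-(2 * N))..(-N), X N t :=
      intervalIntegral.integral_nonneg (by linarith) fun t _ => hX0 N hNpos.le t
    have hpos2 : 0 ≤ ∫ t in N..(2 * N), X N t :=
      intervalIntegral.integral_nonneg (by linarith) fun t _ => hX0 N hNpos.le t
    have hsel : ∀ a b, b - a = N → ∫ t in a..b, X N t < d → ∃ s ∈ Icc a b, |V N s| ≤ 2 * l := by
      intro a b hab hlt
      by_contra! hcon
      have hAbig : ∀ s ∈ Icc a b, d / N ≤ X N s := by
        intro s hs
        have h1 := hcon s hs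
        have h2 : V N s ^ 2 ≤ 2 * N * A N s := hVA N hNpos s
        have h3 : (2 * l) ^ 2 < V N s ^ 2 := by
          rw [← sq_abs (V N s)]
          exact pow_lt_pow_left₀ h1 (by positivity) two_ne_zero
        rw [div_le_iff₀ hNpos]
        have := mul_le_mul_of_nonneg_left (hAX N hNpos s) hNpos.le
        nlinarith
      have := intervalIntegral.integral_mono_on (by linarith) intervalIntegrable_const
        (hXi N a b) hAbig
      rw [intervalIntegral.integral_const, smul_eq_mul, hab, mul_div_cancel₀ _ hNpos.ne'] at this
      linarith
    obtain ⟨s, hs, hVs⟩ := hsel N (2 * N) (by ring) (by linarith)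
    obtain ⟨r, hr, hVr⟩ := hsel (-(2 * N)) (-N) (by ring) (by linarith)
    have hrT : r ≤ -T := by linarith [hr.2]
    have hsT : T ≤ s := by linarith [hs.1]
    have h1 : 9 / 16 * E M T ≤ ∫ t in r..s, A N t := by
      calc 9 / 16 * E M T ≤ ∫ t in -T..T, A N t := by
            rw [hE, ← intervalIntegral.integral_const_mul]
            exact intervalIntegral.integral_mono_on (by linarith) ((hXi _ _ _).const_mul _)
              (hAi _ _ _) fun t _ => hXA M N hM hNpos (by linarith) t
        _ ≤ _ := intervalIntegral.integral_mono_interval hrT (by linarith) hsT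
              (Filter.Eventually.of_forall (hA0 N hNpos)) (hAi _ _ _)
    have hDint : ∫ t in (-(2 * N))..(2 * N), D N t ≤ 2 * d := by
      have : ∫ t in (-(2 * N))..(2 * N), D N t ≤ ∫ t in (-(2 * N))..(2 * N),
          ((N₀ / N) ^ 2 * X N₀ t + (X N t - X N₀ t)) :=
        intervalIntegral.integral_mono_on (by linarith) (hDi _ _ _)
          (((hXi _ _ _).const_mul _).add ((hXi _ _ _).sub (hXi _ _ _))) fun t _ =>
          integral_sq_mul_cutoff_mul_le (hmt t) (fun p => hm0 _) hN₀ hNpos (by linarith)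
      rw [intervalIntegral.integral_add ((hXi _ _ _).const_mul _) ((hXi _ _ _).sub (hXi _ _ _)),
        intervalIntegral.integral_const_mul,
        intervalIntegral.integral_sub (hXi _ _ _) (hXi _ _ _)] at this
      change _ ≤ (N₀ / N) ^ 2 * E N₀ (2 * N) + (E N (2 * N) - E N₀ (2 * N)) at this
      have a1 := hle N (2 * N) (by linarith) (by linarith)
      have a2 := hEmono N₀ N₀ T₀ (2 * N) hN₀ le_rfl hT₀ (by linarith)
      have a3 : (N₀ / N) ^ 2 * E N₀ (2 * N) ≤ (N₀ / N) ^ 2 * C :=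
        mul_le_mul_of_nonneg_left (hEC _ _ hN₀ (by linarith)) (sq_nonneg _)
      have a4 : (N₀ / N) ^ 2 * C ≤ d := by
        rw [div_pow, div_mul_eq_mul_div, div_le_iff₀ (by positivity)]
        have : N₀ ^ 2 * C ≤ d * N := by
          have : N₀ ^ 2 * C / d ≤ N := by linarith
          rw [div_le_iff₀ hdpos] at this
          linarith
        have : d * N ≤ d * N ^ 2 := mul_le_mul_of_nonneg_left (by nlinarith) hdpos.le
        linarith
      linarith
    have hBint : -(∫ t in r..s, B N t) ≤ 4 * l + 8 * K / l * (2 * d) := by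
      have hrs : r ≤ s := by linarith
      have b1 : -(∫ t in r..s, B N t) ≤ ∫ t in r..s, (l / N + 8 * K / l * D N t) := by
        rw [← intervalIntegral.integral_neg]
        refine intervalIntegral.integral_mono_on hrs (hBi _ _ _).neg
          (intervalIntegrable_const.add ((hDi _ _ _).const_mul _)) fun t _ => ?_
        have := (abs_le.1 (hBabs N hNpos l hl t)).1
        linarith
      rw [intervalIntegral.integral_add intervalIntegrable_const ((hDi _ _ _).const_mul _),
        intervalIntegral.integral_const, intervalIntegral.integral_const_mul, smul_eq_mul] at b1
      have b2 : ∫ t in r..s, D N t ≤ ∫ t in (-(2 * N))..(2 * N), D N t :=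
        intervalIntegral.integral_mono_interval hr.1 hrs hs.2
          (Filter.Eventually.of_forall (hD0 N hNpos)) (hDi _ _ _)
      have b3 : (s - r) * (l / N) ≤ 4 * l := by
        rw [mul_div_assoc', div_le_iff₀ hNpos]
        have := mul_le_mul_of_nonneg_right (show s - r ≤ 4 * N by linarith [hs.2, hr.1]) hl.le
        linarith
      have b4 : 8 * K / l * ∫ t in r..s, D N t ≤ 8 * K / l * (2 * d) :=
        mul_le_mul_of_nonneg_left (b2.trans hDint) (by positivity)
      linarith
    have e : 8 * K / l * (2 * d) = 16 * K * l := by rw [hd]; field_simp; norm_num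
    rw [e] at hBint
    have h3 := hFTC N hNpos r s
    have := (abs_le.1 hVr).2
    have := (abs_le.1 hVs).1
    linarith
  obtain ⟨t, p⟩ := x
  by_contra hne
  have hpos : 0 < m (t, p) := lt_of_le_of_ne (hm0 _) (Ne.symm hne)
  have ht := abs_lt.1 (lt_add_one |t|)
  have hp := abs_lt.1 (lt_add_one |p|)
  have hXpos : 0 < X (|p| + 1) t :=
    intervalIntegral.integral_pos (by linarith [abs_nonneg p]) (hmt t).continuousOn
      (fun _ _ => hm0 _)
      ⟨p, ⟨hp.1.le, hp.2.le⟩, hpos⟩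
  have hEpos : 0 < E (|p| + 1) (|t| + 1) :=
    intervalIntegral.integral_pos (by linarith [abs_nonneg p, abs_nonneg t]) (hXc _).continuousOn
      (fun _ _ => hX0 _ (by positivity) _) ⟨t, ⟨ht.1.le, ht.2.le⟩, hXpos⟩
  have := hEsmall (|p| + 1) (|t| + 1) (by positivity) (by positivity)
    (E (|p| + 1) (|t| + 1) / (2 * (8 + 16 * K))) (by positivity)
  have e : (8 + 16 * K) * (E (|p| + 1) (|t| + 1) / (2 * (8 + 16 * K))) =
      E (|p| + 1) (|t| + 1) / 2 := by field_simp
  rw [e] at this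
  linarith

theorem hasDerivAt_cutoff (N p : ℝ) :
    HasDerivAt (cutoff N) (-(4 * (p / N ^ 2) * (1 - (p / N) ^ 2))) p := by
  have h := ((((hasDerivAt_id p).div_const N).fun_pow 2).const_sub 1).fun_pow 2
  refine h.congr_deriv ?_
  simp only [id_eq, Nat.cast_ofNat]
  ring

/-- Hopf-type rigidity: a global `C¹` solution `W(p,q,t)`, periodic in `q`, of the Riccati
equation along the Newton flow with force `-G(q,t)` vanishes. -/
theorem riccati_solution_eq_zero {W Wp Wq Wt : ℝ × ℝ × ℝ → ℝ} {G Gq : ℝ × ℝ → ℝ}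
    (hW : Continuous W) (hWp : Continuous Wp) (hWq : Continuous Wq) (hWt : Continuous Wt)
    (hG : Continuous G) (hGq : Continuous Gq)
    (dWp : ∀ p q t, HasDerivAt (fun p => W (p, q, t)) (Wp (p, q, t)) p)
    (dWq : ∀ p q t, HasDerivAt (fun q => W (p, q, t)) (Wq (p, q, t)) q)
    (dWt : ∀ p q t, HasDerivAt (fun t => W (p, q, t)) (Wt (p, q, t)) t)
    (dGq : ∀ q t, HasDerivAt (fun q => G (q, t)) (Gq (q, t)) q)
    (hWper : ∀ p t, Function.Periodic (fun q => W (p, q, t)) 1)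
    (hGper : ∀ t, Function.Periodic (fun q => G (q, t)) 1)
    (hriccati : ∀ p q t, Wt (p, q, t) + p * Wq (p, q, t) - G (q, t) * Wp (p, q, t)
      + W (p, q, t) ^ 2 + Gq (q, t) = 0)
    {K : ℝ} (hK : 0 < K) (hGK : ∀ t, ∫ q in (0 : ℝ)..1, G (q, t) ^ 2 ≤ K) (p q t : ℝ) :
    W (p, q, t) = 0 := by
  set m : ℝ × ℝ → ℝ := fun x => ∫ q in (0 : ℝ)..1, W (x.2, q, x.1) ^ 2 with hm
  set n : ℝ × ℝ → ℝ := fun x => ∫ q in (0 : ℝ)..1, W (x.2, q, x.1) with hn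
  set r : ℝ × ℝ → ℝ := fun x => ∫ q in (0 : ℝ)..1, G (q, x.1) * W (x.2, q, x.1) with hr
  set rp : ℝ × ℝ → ℝ := fun x => ∫ q in (0 : ℝ)..1, G (q, x.1) * Wp (x.2, q, x.1) with hrp
  set φ' : ℝ → ℝ → ℝ := fun N p => -(4 * (p / N ^ 2) * (1 - (p / N) ^ 2)) with hφ'
  have hmc : Continuous m :=
    intervalIntegral.continuous_parametric_intervalIntegral_of_continuous'
      (f := fun (x : ℝ × ℝ) q => W (x.2, q, x.1) ^ 2) (by unfold Function.uncurry; fun_prop) _ _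
  have hnc : Continuous n :=
    intervalIntegral.continuous_parametric_intervalIntegral_of_continuous'
      (f := fun (x : ℝ × ℝ) q => W (x.2, q, x.1)) (by unfold Function.uncurry; fun_prop) _ _
  have hrc : Continuous r :=
    intervalIntegral.continuous_parametric_intervalIntegral_of_continuous'
      (f := fun (x : ℝ × ℝ) q => G (q, x.1) * W (x.2, q, x.1))
      (by unfold Function.uncurry; fun_prop) _ _
  have hrpc : Continuous rp :=
    intervalIntegral.continuous_parametric_intervalIntegral_of_continuous'
      (f := fun (x : ℝ × ℝ) q => G (q, x.1) * Wp (x.2, q, x.1))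
      (by unfold Function.uncurry; fun_prop) _ _
  have hφ'c : ∀ N, Continuous (φ' N) := fun N => by rw [hφ']; fun_prop
  have hm0 : ∀ x, 0 ≤ m x := fun x =>
    intervalIntegral.integral_nonneg zero_le_one fun _ _ => sq_nonneg _
  have hn_le : ∀ x, n x ^ 2 ≤ m x := fun x => by
    have := sq_intervalIntegral_mul_le zero_le_one (f := fun q => W (x.2, q, x.1))
      (g := fun _ => 1) (by fun_prop) (by fun_prop)
    simpa using this
  have hr_le : ∀ x, r x ^ 2 ≤ K * m x := fun x =>
    (sq_intervalIntegral_mul_le zero_le_one (f := fun q => G (q, x.1))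
      (g := fun q => W (x.2, q, x.1)) (by fun_prop) (by fun_prop)).trans
      (mul_le_mul_of_nonneg_right (hGK _) (hm0 x))
  have dn : ∀ t p, HasDerivAt (fun t => n (t, p)) (rp (t, p) - m (t, p)) t := by
    intro t p
    have h1 := hasDerivAt_intervalIntegral_of_continuous (a := 0) (b := 1)
      (F := fun z : ℝ × ℝ => W (p, z.2, z.1)) (F' := fun z => Wt (p, z.2, z.1))
      (by fun_prop) (by fun_prop) (fun t q => dWt p q t) t
    refine h1.congr_deriv ?_
    have e : ∀ q, Wt (p, q, t) = (G (q, t) * Wp (p, q, t) - W (p, q, t) ^ 2)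
        - (p * Wq (p, q, t) + Gq (q, t)) := fun q => by linarith [hriccati p q t]
    simp_rw [e]
    have h2 : ∫ q in (0 : ℝ)..1, Wq (p, q, t) = 0 := by
      rw [intervalIntegral.integral_eq_sub_of_hasDerivAt (fun q _ => dWq p q t)
        (Continuous.intervalIntegrable (by fun_prop) _ _)]
      have := hWper p t 0
      simp only [zero_add] at this
      linarith
    have h3 : ∫ q in (0 : ℝ)..1, Gq (q, t) = 0 := by
      rw [intervalIntegral.integral_eq_sub_of_hasDerivAt (fun q _ => dGq q t)
        (Continuous.intervalIntegrable (by fun_prop) _ _)]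
      have := hGper t 0
      simp only [zero_add] at this
      linarith
    rw [intervalIntegral.integral_sub, intervalIntegral.integral_sub,
      intervalIntegral.integral_add, intervalIntegral.integral_const_mul, h2, h3]
    · simp [hrp, hm]
    all_goals exact Continuous.intervalIntegrable (by fun_prop) _ _
  have dr : ∀ t p, HasDerivAt (fun p => r (t, p)) (rp (t, p)) p := fun t p =>
    hasDerivAt_intervalIntegral_of_continuous (a := 0) (b := 1)
      (F := fun z : ℝ × ℝ => G (z.2, t) * W (z.1, z.2, t))
      (F' := fun z => G (z.2, t) * Wp (z.1, z.2, t))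
      (by fun_prop) (by fun_prop) (fun p q => (dWp p q t).const_mul (G (q, t))) p
  have key := density_eq_zero_of_dissipation hmc hm0 hK
    (V := fun N t => ∫ p in -N..N, cutoff N p * n (t, p))
    (B := fun N t => ∫ p in -N..N, φ' N p * r (t, p)) ?_ ?_ ?_ ?_
  · obtain ⟨y, hy, hqy⟩ := (hWper p t).exists_mem_Ico₀ zero_lt_one q
    change W (p, q, t) = W (p, y, t) at hqy
    rw [hqy]
    by_contra hne
    have hpos : 0 < m (t, p) := intervalIntegral.integral_pos zero_lt_one
      (Continuous.continuousOn (by fun_prop)) (fun _ _ => sq_nonneg _)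
      ⟨y, ⟨hy.1, hy.2.le⟩, by simp only; positivity⟩
    exact hpos.ne' (key _)
  · intro N
    have := hφ'c N
    exact intervalIntegral.continuous_parametric_intervalIntegral_of_continuous'
      (f := fun t p => φ' N p * r (t, p)) (by unfold Function.uncurry; fun_prop) _ _
  · intro N hN t
    have hc := continuous_cutoff N
    have := hφ'c N
    have h1 := hasDerivAt_intervalIntegral_of_continuous (a := -N) (b := N)
      (F := fun z : ℝ × ℝ => cutoff N z.2 * n z)
      (F' := fun z => cutoff N z.2 * (rp z - m z))
      (by fun_prop) (by fun_prop) (fun t p => (dn t p).const_mul (cutoff N p)) t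
    refine h1.congr_deriv ?_
    have h2 := intervalIntegral.integral_mul_deriv_eq_deriv_mul (a := -N) (b := N)
      (fun p _ => hasDerivAt_cutoff N p) (fun p _ => dr t p)
      ((hφ'c N).intervalIntegrable _ _) (Continuous.intervalIntegrable (by fun_prop) _ _)
    have c1 : cutoff N N = 0 := by simp [cutoff, hN.ne']
    have c2 : cutoff N (-N) = 0 := by simp [cutoff, hN.ne']
    rw [c1, c2] at h2
    simp only [mul_sub]
    rw [intervalIntegral.integral_sub, h2]
    · simp only [hφ']; ring
    all_goals exact Continuous.intervalIntegrable (by fun_prop) _ _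
  · intro N hN t
    have hc := continuous_cutoff N
    have h1 := sq_intervalIntegral_mul_le (a := -N) (b := N) (by linarith)
      (f := fun _ => 1) (g := fun p => cutoff N p * n (t, p)) (by fun_prop) (by fun_prop)
    simp only [one_mul, one_pow, intervalIntegral.integral_const, smul_eq_mul, mul_one] at h1
    refine h1.trans ?_
    rw [show N - -N = 2 * N by ring]
    refine mul_le_mul_of_nonneg_left ?_ (by positivity)
    refine intervalIntegral.integral_mono_on (by linarith)
      (Continuous.intervalIntegrable (by fun_prop) _ _)
      (Continuous.intervalIntegrable (by fun_prop) _ _) fun p hp => ?_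
    have a1 := cutoff_le_one hN hp
    have a2 := cutoff_nonneg N p
    have a3 := hn_le (t, p)
    rw [mul_pow]
    exact mul_le_mul (by nlinarith) a3 (sq_nonneg _) a2
  · intro N hN t
    have hc := continuous_cutoff N
    have := hφ'c N
    have h1 := sq_intervalIntegral_mul_le (a := -N) (b := N) (by linarith)
      (f := fun _ => 1) (g := fun p => φ' N p * r (t, p)) (by fun_prop) (by fun_prop)
    simp only [one_mul, one_pow, intervalIntegral.integral_const, smul_eq_mul, mul_one] at h1
    refine h1.trans ?_
    rw [show N - -N = 2 * N by ring, show 32 * K / N = 2 * N * (16 * K / N ^ 2) by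
      field_simp; norm_num, mul_assoc (2 * N)]
    refine mul_le_mul_of_nonneg_left ?_ (by positivity)
    rw [← intervalIntegral.integral_const_mul]
    refine intervalIntegral.integral_mono_on (by linarith)
      (Continuous.intervalIntegrable (by fun_prop) _ _)
      (Continuous.intervalIntegrable (by fun_prop) _ _) fun p hp => ?_
    have e : 16 * K / N ^ 2 * ((p / N) ^ 2 * (cutoff N p * m (t, p))) =
        φ' N p ^ 2 * (K * m (t, p)) := by
      simp only [hφ', cutoff]; field_simp; ring
    rw [mul_pow, e]
    exact mul_le_mul_of_nonneg_left (hr_le (t, p)) (sq_nonneg _)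

/-- The inverse of a bijective `C¹` map with injective derivatives is `C¹`. -/
theorem contDiff_of_inverse {E : Type*} [NormedAddCommGroup E] [NormedSpace ℝ E]
    [FiniteDimensional ℝ E] {Φ Ψ : E → E} (hΦ : ContDiff ℝ 1 Φ)
    (hl : Function.LeftInverse Ψ Φ) (hr : Function.RightInverse Ψ Φ)
    (hinj : ∀ x, Function.Injective (fderiv ℝ Φ x)) : ContDiff ℝ 1 Ψ := by
  have : CompleteSpace E := FiniteDimensional.complete ℝ E
  rw [contDiff_iff_contDiffAt]
  intro y
  set x := Ψ y with hx
  set L : E ≃L[ℝ] E :=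
    (LinearEquiv.ofInjectiveEndo (fderiv ℝ Φ x : E →ₗ[ℝ] E) (hinj x)).toContinuousLinearEquiv
    with hL
  have hder : HasFDerivAt Φ (L : E →L[ℝ] E) x := by
    have h := (hΦ.differentiable one_ne_zero x).hasFDerivAt
    refine h.congr_fderiv ?_
    ext v
    simp [hL]
  have h1 := hΦ.contDiffAt.to_localInverse hder one_ne_zero
  rw [hr y] at h1
  refine h1.congr_of_eventuallyEq ?_
  have h2 := (hΦ.contDiffAt.hasStrictFDerivAt' hder one_ne_zero).eventually_right_inverse
  rw [hr y] at h2
  filter_upwards [h2] with z hz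
  exact hl.injective ((hr z).trans hz.symm)

section partials

variable {H : ℝ × ℝ × ℝ → ℝ}

theorem hasDerivAt_first (hH : Differentiable ℝ H) (a b c : ℝ) :
    HasDerivAt (fun a => H (a, b, c)) (fderiv ℝ H (a, b, c) (1, 0, 0)) a :=
  (hH (a, b, c)).hasFDerivAt.comp_hasDerivAt a
    ((hasDerivAt_id a).prodMk ((hasDerivAt_const a b).prodMk (hasDerivAt_const a c)))

theorem hasDerivAt_second (hH : Differentiable ℝ H) (a b c : ℝ) :
    HasDerivAt (fun b => H (a, b, c)) (fderiv ℝ H (a, b, c) (0, 1, 0)) b :=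
  (hH (a, b, c)).hasFDerivAt.comp_hasDerivAt b
    ((hasDerivAt_const b a).prodMk ((hasDerivAt_id b).prodMk (hasDerivAt_const b c)))

theorem hasDerivAt_third (hH : Differentiable ℝ H) (a b c : ℝ) :
    HasDerivAt (fun c => H (a, b, c)) (fderiv ℝ H (a, b, c) (0, 0, 1)) c :=
  (hH (a, b, c)).hasFDerivAt.comp_hasDerivAt c
    ((hasDerivAt_const c a).prodMk ((hasDerivAt_const c b).prodMk (hasDerivAt_id c)))

end partials

/-- The derivative of a bijection of `ℝ` with differentiable inverse does not vanish. -/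
theorem deriv_ne_zero_of_differentiable_invFun {g : ℝ → ℝ} {g' a : ℝ}
    (hg : Function.Injective g) (hinv : Differentiable ℝ (Function.invFun g))
    (h : HasDerivAt g g' a) : g' ≠ 0 := by
  have h1 := (hinv (g a)).hasDerivAt.comp a h
  have h2 : Function.invFun g ∘ g = id := Function.invFun_comp hg
  rw [h2] at h1
  exact right_ne_zero_of_mul_eq_one (h1.unique (hasDerivAt_id a))

/-- All leaves of a foliated global solution of the forced Burgers equation are horizontal. -/
theorem foliated_slope_eq_zero {F : ℝ × ℝ × ℝ → ℝ} {G : ℝ × ℝ → ℝ}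
    (hF : ContDiff ℝ 2 F) (hG : ContDiff ℝ 1 G)
    (hFper : ∀ α q t, F (α, q + 1, t) = F (α, q, t)) (hGper : ∀ q t, G (q + 1, t) = G (q, t))
    (hburgers : ∀ x, fderiv ℝ F x (0, 0, 1) + F x * fderiv ℝ F x (0, 1, 0) + G x.2 = 0)
    (hbij : ∀ q t, Function.Bijective fun α => F (α, q, t))
    (hFα : ∀ x, fderiv ℝ F x (1, 0, 0) ≠ 0)
    {K : ℝ} (hK : 0 < K) (hGK : ∀ t, ∫ q in (0 : ℝ)..1, G (q, t) ^ 2 ≤ K) (x : ℝ × ℝ × ℝ) :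
    fderiv ℝ F x (0, 1, 0) = 0 := by
  have hFd : Differentiable ℝ F := hF.differentiable two_ne_zero
  have hF' : ContDiff ℝ 1 (fderiv ℝ F) := hF.fderiv_right (by norm_num)
  set Φ : ℝ × ℝ × ℝ → ℝ × ℝ × ℝ := fun x => (F x, x.2) with hΦ
  have hΦc : ContDiff ℝ 1 Φ := (hF.of_le one_le_two).prodMk contDiff_snd
  have hΦ' : ∀ x v, fderiv ℝ Φ x v = (fderiv ℝ F x v, v.2) := fun x v => by
    rw [((hFd x).hasFDerivAt.prodMk hasFDerivAt_snd).fderiv]; rfl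
  have hΦinj : ∀ x, Function.Injective (fderiv ℝ Φ x) := by
    intro x
    rw [injective_iff_map_eq_zero]
    rintro ⟨a, b⟩ hv
    rw [hΦ', Prod.mk_eq_zero] at hv
    obtain ⟨hv, rfl⟩ := hv
    have e : ((a, 0) : ℝ × ℝ × ℝ) = a • (1, 0, 0) := by ext <;> simp
    rw [e, map_smul, smul_eq_mul] at hv
    rw [(mul_eq_zero.1 hv).resolve_right (hFα x)]
    rfl
  have hΦbij : Function.Bijective Φ := by
    constructor
    · rintro ⟨a, q, t⟩ ⟨a', q', t'⟩ h
      simp only [hΦ, Prod.mk.injEq] at h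
      obtain ⟨h, rfl, rfl⟩ := h
      rw [(hbij q t).1 h]
    · rintro ⟨p, q, t⟩
      obtain ⟨a, ha⟩ := (hbij q t).2 p
      exact ⟨(a, q, t), by simpa [hΦ] using ha⟩
  obtain ⟨Ψ, hl, hr⟩ := Function.bijective_iff_has_inverse.1 hΦbij
  have hΨ : ContDiff ℝ 1 Ψ := contDiff_of_inverse hΦc hl hr hΦinj
  set Fq : ℝ × ℝ × ℝ → ℝ := fun x => fderiv ℝ F x (0, 1, 0) with hFq
  set Ft : ℝ × ℝ × ℝ → ℝ := fun x => fderiv ℝ F x (0, 0, 1) with hFt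
  have hFqc : ContDiff ℝ 1 Fq := hF'.clm_apply contDiff_const
  have hFtc : ContDiff ℝ 1 Ft := hF'.clm_apply contDiff_const
  have hF'd : Differentiable ℝ (fderiv ℝ F) := hF'.differentiable one_ne_zero
  have hsecond : ∀ x v w,
      fderiv ℝ (fun x => fderiv ℝ F x v) x w = fderiv ℝ (fderiv ℝ F) x w v := fun x v w => by
    rw [((hF'd x).hasFDerivAt.clm_apply (hasFDerivAt_const v x)).fderiv]; simp
  have hsymm : ∀ x, fderiv ℝ Ft x (0, 1, 0) = fderiv ℝ Fq x (0, 0, 1) := fun x => by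
    rw [hFt, hFq, hsecond, hsecond]
    exact hF.contDiffAt.isSymmSndFDerivAt (by simp) _ _
  set W : ℝ × ℝ × ℝ → ℝ := Fq ∘ Ψ with hW
  have hWc : ContDiff ℝ 1 W := hFqc.comp hΨ
  have hWd : Differentiable ℝ W := hWc.differentiable one_ne_zero
  have hW'c : Continuous (fderiv ℝ W) := hWc.continuous_fderiv one_ne_zero
  have hG'c : Continuous (fderiv ℝ G) := hG.continuous_fderiv one_ne_zero
  have hFqW : Fq = W ∘ Φ := by
    funext x; simp [hW, hl x]
  have hchain : ∀ x v, fderiv ℝ Fq x v = fderiv ℝ W (Φ x) (fderiv ℝ F x v, v.2) := fun x v => by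
    rw [hFqW, fderiv_comp x (hWd _) (hΦc.differentiable one_ne_zero x),
      ContinuousLinearMap.comp_apply, hΦ']
  have dG : ∀ q t, HasDerivAt (fun q => G (q, t)) (fderiv ℝ G (q, t) (1, 0)) q := fun q t =>
    (hG.differentiable one_ne_zero (q, t)).hasFDerivAt.comp_hasDerivAt q
      ((hasDerivAt_id q).prodMk (hasDerivAt_const q t))
  have hdiffq : ∀ a q t, fderiv ℝ Ft (a, q, t) (0, 1, 0) + (Fq (a, q, t) * Fq (a, q, t)
      + F (a, q, t) * fderiv ℝ Fq (a, q, t) (0, 1, 0)) + fderiv ℝ G (q, t) (1, 0) = 0 := by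
    intro a q t
    have h1 := ((hasDerivAt_second (hFtc.differentiable one_ne_zero) a q t).fun_add
      ((hasDerivAt_second hFd a q t).fun_mul
        (hasDerivAt_second (hFqc.differentiable one_ne_zero) a q t))).fun_add (dG q t)
    have h2 : (fun q => Ft (a, q, t) + F (a, q, t) * Fq (a, q, t) + G (q, t)) = fun _ => 0 := by
      funext q; exact hburgers (a, q, t)
    rw [h2] at h1
    exact h1.unique (hasDerivAt_const q 0)
  have hper : ∀ a t, Function.Periodic (fun q => Fq (a, q, t)) 1 := by
    intro a t q
    have h1 := (hasDerivAt_second hFd a (q + 1) t).comp_add_const q 1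
    simp_rw [hFper] at h1
    exact h1.unique (hasDerivAt_second hFd a q t)
  have key := riccati_solution_eq_zero (W := W) (G := G)
    (Wp := fun y => fderiv ℝ W y (1, 0, 0)) (Wq := fun y => fderiv ℝ W y (0, 1, 0))
    (Wt := fun y => fderiv ℝ W y (0, 0, 1)) (Gq := fun y => fderiv ℝ G y (1, 0))
    hWc.continuous (by fun_prop) (by fun_prop) (by fun_prop) hG.continuous (by fun_prop)
    (hasDerivAt_first hWd) (hasDerivAt_second hWd) (hasDerivAt_third hWd) dG ?_
    (fun t q => hGper q t) ?_ hK hGK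
  · have := key (F x) x.2.1 x.2.2
    change W (Φ x) = 0 at this
    rwa [hW, Function.comp_apply, hl x] at this
  · intro p t q
    obtain ⟨a, ha⟩ := (hbij q t).2 p
    simp only at ha
    have e1 : (p, q, t) = Φ (a, q, t) := by simp [hΦ, ha]
    have e2 : (p, q + 1, t) = Φ (a, q + 1, t) := by simp [hΦ, hFper, ha]
    simp only
    rw [e1, e2, hW, Function.comp_apply, Function.comp_apply, hl, hl]
    exact hper a t q
  · intro p q t
    obtain ⟨a, ha⟩ := (hbij q t).2 p
    simp only at ha
    have e1 : (p, q, t) = Φ (a, q, t) := by simp [hΦ, ha]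
    have hWx : W (p, q, t) = Fq (a, q, t) := by rw [e1, hW, Function.comp_apply, hl]
    have h1 := hchain (a, q, t) (0, 1, 0)
    have h2 := hchain (a, q, t) (0, 0, 1)
    have h3 := hdiffq a q t
    have h4 := hburgers (a, q, t)
    rw [hsymm] at h3
    change Ft (a, q, t) + F (a, q, t) * Fq (a, q, t) + G (q, t) = 0 at h4
    have d1 : ((fderiv ℝ F (a, q, t) (0, 1, 0), (1, 0)) : ℝ × ℝ × ℝ) =
        Fq (a, q, t) • (1, 0, 0) + (0, 1, 0) := by simp [hFq]
    have d2 : ((fderiv ℝ F (a, q, t) (0, 0, 1), (0, 1)) : ℝ × ℝ × ℝ) =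
        Ft (a, q, t) • (1, 0, 0) + (0, 0, 1) := by simp [hFt]
    rw [d1, map_add, map_smul, smul_eq_mul, ← e1] at h1
    rw [d2, map_add, map_smul, smul_eq_mul, ← e1] at h2
    rw [h1, h2, ha] at h3
    rw [ha] at h4
    rw [hWx]
    linear_combination h3 - fderiv ℝ W (p, q, t) (1, 0, 0) * h4

/-- (Contrapositive shock-formation theorem.)  Let `u(q,t)` be `C²`,
`1`-periodic in `q`, with `∫₀¹ u_q² dq < K` for all `t`.  Suppose `f(α,q,t)` is a `C²`
family such that: each `f(α,·,·)` is a global classical solution of the forced Burgers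
equation `f_t + f·f_q + u_q = 0`, `f` is `1`-periodic in `q`, and for each fixed `(q,t)`
the map `α ↦ f(α,q,t)` is a `C²` diffeomorphism of `ℝ`.  Then `u_q ≡ 0` and `f(α,q,t)`
does not depend on `(q,t)`. -/
theorem foliated_global_solutions_force_zero_and_horizontal
    (u : ℝ → ℝ → ℝ) (hu : ContDiff ℝ 2 (fun x : ℝ × ℝ => u x.1 x.2))
    (huper : ∀ q t, u (q + 1) t = u q t)
    (uq : ℝ → ℝ → ℝ)
    (huq : ∀ q t, HasDerivAt (fun q' => u q' t) (uq q t) q)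
    (K : ℝ) (hK : 0 < K)
    (hbound : ∀ t, (∫ q in (0:ℝ)..1, (uq q t) ^ 2) < K)
    (f : ℝ → ℝ → ℝ → ℝ)
    (hf : ContDiff ℝ 2 (fun x : ℝ × ℝ × ℝ => f x.1 x.2.1 x.2.2))
    (hfper : ∀ α q t, f α (q + 1) t = f α q t)
    (hburgers : ∀ α q t,
      deriv (fun t' => f α q t') t + f α q t * deriv (fun q' => f α q' t) q + uq q t = 0)
    (hdiffeo : ∀ q t, Function.Bijective (fun α => f α q t) ∧
      ContDiff ℝ 2 (Function.invFun (fun α => f α q t))) :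
    (∀ q t, uq q t = 0) ∧ (∀ α q t q' t', f α q t = f α q' t') := by
  set U : ℝ × ℝ → ℝ := fun x => u x.1 x.2 with hU
  set F : ℝ × ℝ × ℝ → ℝ := fun x => f x.1 x.2.1 x.2.2 with hF
  have hFd : Differentiable ℝ F := hf.differentiable two_ne_zero
  have hG : ContDiff ℝ 1 fun x : ℝ × ℝ => uq x.1 x.2 := by
    have h1 : ContDiff ℝ 1 fun x => fderiv ℝ U x (1, 0) :=
      (hu.fderiv_right (by norm_num)).clm_apply contDiff_const
    refine (funext fun x => (huq x.1 x.2).unique ?_ :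
      (fun x : ℝ × ℝ => uq x.1 x.2) = fun x => fderiv ℝ U x (1, 0)) ▸ h1
    exact (hu.differentiable two_ne_zero x).hasFDerivAt.comp_hasDerivAt x.1
      ((hasDerivAt_id x.1).prodMk (hasDerivAt_const x.1 x.2))
  have huqper : ∀ q t, uq (q + 1) t = uq q t := by
    intro q t
    have h1 := (huq (q + 1) t).comp_add_const q 1
    simp_rw [huper] at h1
    exact h1.unique (huq q t)
  have dt : ∀ α q t, HasDerivAt (fun t => f α q t) (fderiv ℝ F (α, q, t) (0, 0, 1)) t :=
    hasDerivAt_third hFd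
  have dq : ∀ α q t, HasDerivAt (fun q => f α q t) (fderiv ℝ F (α, q, t) (0, 1, 0)) q :=
    hasDerivAt_second hFd
  have hslope : ∀ x, fderiv ℝ F x (0, 1, 0) = 0 := by
    refine foliated_slope_eq_zero hf hG hfper huqper ?_ (fun q t => (hdiffeo q t).1) ?_ hK
      (fun t => (hbound t).le)
    · rintro ⟨α, q, t⟩
      have := hburgers α q t
      rwa [(dt α q t).deriv, (dq α q t).deriv] at this
    · rintro ⟨α, q, t⟩
      exact deriv_ne_zero_of_differentiable_invFun (hdiffeo q t).1.1
        ((hdiffeo q t).2.differentiable two_ne_zero) (hasDerivAt_first hFd α q t)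
  have hconst : ∀ α q q' t, f α q t = f α q' t := fun α q q' t =>
    is_const_of_deriv_eq_zero (fun q => (dq α q t).differentiableAt)
      (fun q => (dq α q t).deriv.trans (hslope _)) q q'
  have hft : ∀ α q t, deriv (fun t' => f α q t') t = -uq q t := by
    intro α q t
    have := hburgers α q t
    rw [(dq α q t).deriv, hslope] at this
    linarith
  have huq0 : ∀ q t, uq q t = 0 := by
    intro q t
    obtain ⟨ξ, -, hξ⟩ := exists_hasDerivAt_eq_zero (zero_lt_one (α := ℝ))
      (fun q _ => (huq q t).continuousAt.continuousWithinAt)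
      (by simpa using (huper 0 t).symm) (fun q _ => huq q t)
    have h1 := hft 0 q t
    simp_rw [hconst 0 q ξ] at h1
    rw [hft, hξ] at h1
    linarith
  refine ⟨huq0, fun α q t q' t' => (hconst α q q' t).trans ?_⟩
  exact is_const_of_deriv_eq_zero (fun t => (dt α q' t).differentiableAt)
    (fun t => by rw [hft, huq0, neg_zero]) t t'
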